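/- Let n ≥ 1, R > 0, 1 < p < ∞, b > 1, a < n and 0 < c < (n-a)/(b-1). Then for every complex-valued function f ∈ C_0^1(B(0,R)\{0}) one has ((b-1)c/p)^p · ∫_{B(0,R)} |f(x)|^p / (|x|^a (1-(|x|/R)^c)^b) dx + (n - a - (b-1)c) · ((b-1)c/p)^{p-1} · ∫_{B(0,R)} |f(x)|^p / (|x|^a (1-(|x|/R)^c)^{b-1}) dx ≤ ∫_{B(0,R)} |𝓡f(x)|^p / (|x|^{a-p} (1-(|x|/R)^c)^{b-p}) dx. -/

import Mathlib

open MeasureTheory Metric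

/-- The radial derivative `𝓡f(x) = Df(x)[x/|x|]` of a complex-valued function on `ℝⁿ`. -/
noncomputable def radDeriv {n : ℕ} (f : EuclideanSpace ℝ (Fin n) → ℂ)
    (x : EuclideanSpace ℝ (Fin n)) : ℂ :=
  fderiv ℝ f x (‖x‖⁻¹ • x)

/-- The divergence theorem for the vector field `x ↦ G x • x` with `G` of class `C¹` and compactly
supported. -/
lemma integral_fderiv_self_add_mul_eq_zero {n : ℕ} {G : EuclideanSpace ℝ (Fin n) → ℝ}
    (hG : ContDiff ℝ 1 G) (hcomp : HasCompactSupport G) :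
    Integrable (fun x => fderiv ℝ G x x + n * G x) ∧ ∫ x, (fderiv ℝ G x x + n * G x) = 0 := by
  have hG' : Continuous (fderiv ℝ G) := hG.continuous_fderiv one_ne_zero
  have hGint : Integrable G := hG.continuous.integrable_of_hasCompactSupport hcomp
  have hone (i : Fin n) (x : EuclideanSpace ℝ (Fin n)) :
      fderiv ℝ (EuclideanSpace.proj i : EuclideanSpace ℝ (Fin n) →L[ℝ] ℝ) x
        (EuclideanSpace.single i 1) = 1 := by
    rw [ContinuousLinearMap.fderiv]; simp
  let L (i : Fin n) : EuclideanSpace ℝ (Fin n) →L[ℝ] ℝ := EuclideanSpace.proj i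
  let e (i : Fin n) : EuclideanSpace ℝ (Fin n) := EuclideanSpace.single i 1
  have hint (i : Fin n) : Integrable (fun x => L i x * fderiv ℝ G x (e i)) :=
    ((L i).continuous.mul (hG'.clm_apply continuous_const)).integrable_of_hasCompactSupport
      (hcomp.fderiv_apply ℝ (e i)).mul_left
  have hparts (i : Fin n) : ∫ x, L i x * fderiv ℝ G x (e i) = -∫ x, G x := by
    rw [integral_mul_fderiv_eq_neg_fderiv_mul_of_integrable
      (by simpa only [L, e, hone, one_mul] using hGint) (hint i)
      (((L i).continuous.mul hG.continuous).integrable_of_hasCompactSupport hcomp.mul_left)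
      (fun x _ => (L i).differentiableAt)
      (fun x _ => hG.differentiable one_ne_zero x)]
    simp only [L, e, hone, one_mul]
  have hsum (x : EuclideanSpace ℝ (Fin n)) :
      fderiv ℝ G x x = ∑ i, L i x * fderiv ℝ G x (e i) := by
    have hx : x = ∑ i, x i • e i := by
      ext j
      simp [e, Pi.single_apply]
    refine (congrArg (fderiv ℝ G x) hx).trans ?_
    simp [L]
  have hsumint : Integrable (fun x => fderiv ℝ G x x) := by
    simp_rw [hsum]
    exact integrable_finsetSum _ fun i _ => hint i
  refine ⟨hsumint.add (hGint.const_mul _), ?_⟩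
  rw [integral_add hsumint (hGint.const_mul _)]
  simp_rw [hsum]
  rw [integral_finsetSum _ fun i _ => hint i, integral_const_mul]
  simp [hparts]

lemma weighted_young_inequality {p K F D r u a b : ℝ} (hp : 1 < p) (hK : 0 ≤ K) (hF : 0 ≤ F)
    (hD : 0 ≤ D) (hr : 0 < r) (hu : 0 < u) :
    K ^ (p - 1) * (r ^ (-a) * u ^ (1 - b) * (p * F ^ (p - 1) * (r * D))) ≤
      (p - 1) * K ^ p * (F ^ p / (r ^ a * u ^ b)) + D ^ p / (r ^ (a - p) * u ^ (b - p)) := by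
  have hp0 : 0 < p := by linarith
  have hpq : p.HolderConjugate (p / (p - 1)) := Real.HolderConjugate.conjExponent hp
  have hB : 0 ≤ D * r * u := by positivity
  have hy := Real.young_inequality_of_nonneg hB
    (Real.rpow_nonneg (mul_nonneg hK hF) (p - 1)) hpq
  rw [← Real.rpow_mul (by positivity), mul_div_cancel₀ _ (by linarith : p - 1 ≠ 0),
    Real.mul_rpow hK hF, Real.mul_rpow hK hF, Real.mul_rpow (by positivity) hu.le,
    Real.mul_rpow hD hr.le] at hy
  rw [Real.rpow_sub hr, Real.rpow_sub hu, Real.rpow_sub hu, Real.rpow_one, Real.rpow_neg hr.le]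
  have hmul := mul_le_mul_of_nonneg_left hy (show 0 ≤ p / (r ^ a * u ^ b) by positivity)
  refine le_of_eq_of_le ?_ (hmul.trans_eq ?_) <;> field_simp
  ring

lemma hasDerivAt_hardyWeight {a b c R r : ℝ} (hR : 0 < R) (hc : 0 < c) (hr : 0 < r) (hrR : r < R) :
    HasDerivAt (fun r : ℝ => r ^ (-a) * (1 - (r / R) ^ c) ^ (1 - b))
      (r⁻¹ * ((b - 1) * c * (1 / (r ^ a * (1 - (r / R) ^ c) ^ b)) -
        (a + (b - 1) * c) * (1 / (r ^ a * (1 - (r / R) ^ c) ^ (b - 1))))) r := by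
  have hrR' : 0 < r / R := by positivity
  have hu : 0 < 1 - (r / R) ^ c :=
    sub_pos.2 (Real.rpow_lt_one hrR'.le ((div_lt_one hR).2 hrR) hc)
  have h1 : HasDerivAt (fun r : ℝ => r ^ (-a)) _ r := Real.hasDerivAt_rpow_const (Or.inl hr.ne')
  have h2 : HasDerivAt (fun r : ℝ => 1 - (r / R) ^ c) _ r :=
    (((hasDerivAt_id r).div_const R).rpow_const (p := c) (Or.inl hrR'.ne')).const_sub 1
  refine (h1.mul (h2.rpow_const (p := 1 - b) (Or.inl hu.ne'))).congr_deriv ?_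
  simp only [id]
  set u := 1 - (r / R) ^ c with hu_def
  have hq : (r / R) ^ c = 1 - u := by rw [hu_def]; ring
  rw [Real.rpow_sub hrR', Real.rpow_one, hq, show 1 - b - 1 = -b by ring,
    Real.rpow_sub hr, Real.rpow_one, Real.rpow_sub hu, Real.rpow_sub hu, Real.rpow_one,
    Real.rpow_neg hr.le, Real.rpow_neg hu.le]
  field_simp
  ring

section Weight

variable {E : Type*} [NormedAddCommGroup E] {R c : ℝ} {x : E}

lemma one_sub_norm_div_rpow_pos (hR : 0 < R) (hc : 0 < c) (hxR : ‖x‖ < R) :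
    0 < 1 - (‖x‖ / R) ^ c :=
  sub_pos.2 (Real.rpow_lt_one (by positivity) ((div_lt_one hR).2 hxR) hc)

lemma contDiffAt_hardyWeight [InnerProductSpace ℝ E] (hR : 0 < R) (hc : 0 < c) (hx : x ≠ 0) (hxR : ‖x‖ < R) (s t : ℝ) :
    ContDiffAt ℝ 1 (fun x : E => ‖x‖ ^ s * (1 - (‖x‖ / R) ^ c) ^ t) x := by
  have hn : ContDiffAt ℝ 1 (fun x : E => ‖x‖) x := contDiffAt_norm ℝ hx
  have hpos : 0 < ‖x‖ := norm_pos_iff.2 hx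
  exact (hn.rpow_const_of_ne hpos.ne').mul
    ((contDiffAt_const.sub ((hn.div_const R).rpow_const_of_ne (by positivity))).rpow_const_of_ne
      (one_sub_norm_div_rpow_pos hR hc hxR).ne')

end Weight

lemma integrable_div_hardyWeight {n : ℕ} {R c : ℝ} (hR : 0 < R) (hc : 0 < c)
    {S : Set (EuclideanSpace ℝ (Fin n))} (hS : IsCompact S) (hSsub : S ⊆ ball 0 R \ {0})
    {g : EuclideanSpace ℝ (Fin n) → ℝ} (hg : ContinuousOn g S) (hgS : ∀ x ∉ S, g x = 0)
    (s t : ℝ) :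
    Integrable (fun x => g x / (‖x‖ ^ s * (1 - (‖x‖ / R) ^ c) ^ t)) := by
  rw [← integrableOn_iff_integrable_of_support_subset (s := S)]
  · refine ContinuousOn.integrableOn_compact hS (hg.div (fun x hx => ?_) fun x hx => ?_)
    · exact (contDiffAt_hardyWeight hR hc (hSsub hx).2 (by simpa using (hSsub hx).1)
        s t).continuousAt.continuousWithinAt
    · have h1 := one_sub_norm_div_rpow_pos hR hc (by simpa using (hSsub hx).1 : ‖x‖ < R)
      have h2 : 0 < ‖x‖ := norm_pos_iff.2 (hSsub hx).2
      positivity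
  · intro x hx
    by_contra hxS
    simp [hgS x hxS] at hx

lemma abs_fderiv_norm_rpow_apply_le {E F : Type*} [NormedAddCommGroup E] [NormedSpace ℝ E]
    [NormedAddCommGroup F] [InnerProductSpace ℝ F] {f : E → F} {x : E}
    (hf : DifferentiableAt ℝ f x) {p : ℝ} (hp : 1 < p) (v : E) :
    |fderiv ℝ (fun x => ‖f x‖ ^ p) x v| ≤ p * ‖f x‖ ^ (p - 1) * ‖fderiv ℝ f x v‖ := by
  have h := ((hasFDerivAt_norm_rpow (f x) hp).comp x hf.hasFDerivAt).fderiv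
  change fderiv ℝ (fun x => ‖f x‖ ^ p) x = _ at h
  rw [h]
  have hp0 : 0 < p := by linarith
  simp only [ContinuousLinearMap.comp_apply, smul_apply, smul_eq_mul,
    innerSL_apply_apply, abs_mul]
  rw [abs_of_pos hp0, abs_of_nonneg (Real.rpow_nonneg (norm_nonneg _) _)]
  rcases eq_or_ne (f x) 0 with h0 | h0
  · rw [h0]
    simp only [inner_zero_left, abs_zero, mul_zero]
    positivity
  calc p * ‖f x‖ ^ (p - 2) * |inner ℝ (f x) (fderiv ℝ f x v)|
      ≤ p * ‖f x‖ ^ (p - 2) * (‖f x‖ * ‖fderiv ℝ f x v‖) := by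
        gcongr
        exact abs_real_inner_le_norm _ _
    _ = p * ‖f x‖ ^ (p - 1) * ‖fderiv ℝ f x v‖ := by
        rw [show p - 1 = p - 2 + 1 by ring, Real.rpow_add_one (norm_ne_zero_iff.2 h0)]
        ring

theorem unified_hardy_inequality_with_remainder {n : ℕ} (hn : 1 ≤ n) {R : ℝ} (hR : 0 < R)
    {p b a c : ℝ} (hp : 1 < p) (hb : 1 < b) (ha : a < (n : ℝ))
    (hc0 : 0 < c) (hc : c < ((n : ℝ) - a) / (b - 1))
    (f : EuclideanSpace ℝ (Fin n) → ℂ)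
    (hf : ContDiff ℝ 1 f) (hcomp : HasCompactSupport f)
    (hsupp : tsupport f ⊆ ball (0 : EuclideanSpace ℝ (Fin n)) R \ {0}) :
    ((b - 1) * c / p) ^ p *
      (∫ x in ball (0 : EuclideanSpace ℝ (Fin n)) R,
        ‖f x‖ ^ p / (‖x‖ ^ a * (1 - (‖x‖ / R) ^ c) ^ b)) +
    ((n : ℝ) - a - (b - 1) * c) * ((b - 1) * c / p) ^ (p - 1) *
      (∫ x in ball (0 : EuclideanSpace ℝ (Fin n)) R,
        ‖f x‖ ^ p / (‖x‖ ^ a * (1 - (‖x‖ / R) ^ c) ^ (b - 1))) ≤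
    ∫ x in ball (0 : EuclideanSpace ℝ (Fin n)) R,
        ‖radDeriv f x‖ ^ p / (‖x‖ ^ (a - p) * (1 - (‖x‖ / R) ^ c) ^ (b - p)) := by
  set S := tsupport f
  have hScomp : IsCompact S := hcomp
  set K := (b - 1) * c / p with hK
  have hp0 : 0 < p := by linarith
  have hKpos : 0 < K := div_pos (mul_pos (by linarith) hc0) hp0
  have hf0 (x) (hx : x ∉ S) : f x = 0 := image_eq_zero_of_notMem_tsupport hx
  have hfp0 (x) (hx : x ∉ S) : ‖f x‖ ^ p = 0 := by
    rw [hf0 x hx, norm_zero, Real.zero_rpow hp0.ne']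
  have hrad0 (x) (hx : x ∉ S) : ‖radDeriv f x‖ ^ p = 0 := by
    have : fderiv ℝ f x = 0 :=
      Function.notMem_support.1 fun h => hx (support_fderiv_subset ℝ h)
    rw [radDeriv, this]
    simp [Real.zero_rpow hp0.ne']
  have hφ : ContDiff ℝ 1 (fun x => ‖f x‖ ^ p) := hf.norm_rpow hp
  have hradcont : ContinuousOn (fun x => ‖radDeriv f x‖ ^ p) S := by
    refine ContinuousOn.rpow_const (ContinuousOn.norm ?_) fun _ _ => Or.inr hp0.le
    refine (hf.continuous_fderiv one_ne_zero).continuousOn.clm_apply ?_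
    exact (continuousOn_id.norm.inv₀ fun x hx => norm_ne_zero_iff.2 (hsupp hx).2).smul
      continuousOn_id
  have hint (s t : ℝ) := integrable_div_hardyWeight hR hc0 hScomp hsupp
    hφ.continuous.continuousOn hfp0 s t
  have hintrad := integrable_div_hardyWeight hR hc0 hScomp hsupp hradcont hrad0 (a - p) (b - p)
  have hball {g : EuclideanSpace ℝ (Fin n) → ℝ} (hg : ∀ x ∉ S, g x = 0) (s t : ℝ) :
      ∫ x in ball (0 : EuclideanSpace ℝ (Fin n)) R,
        g x / (‖x‖ ^ s * (1 - (‖x‖ / R) ^ c) ^ t) =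
      ∫ x, g x / (‖x‖ ^ s * (1 - (‖x‖ / R) ^ c) ^ t) :=
    setIntegral_eq_integral_of_forall_compl_eq_zero fun x hx => by
      rw [hg x fun h => hx (hsupp h).1, zero_div]
  rw [hball hfp0, hball hfp0, hball hrad0]
  let w (x : EuclideanSpace ℝ (Fin n)) : ℝ := ‖x‖ ^ (-a) * (1 - (‖x‖ / R) ^ c) ^ (1 - b)
  let G (x : EuclideanSpace ℝ (Fin n)) : ℝ := ‖f x‖ ^ p * w x
  have hGS : tsupport G ⊆ S :=
    closure_minimal (fun x hx => by
      by_contra hxS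
      exact hx (by simp only [G, hfp0 x hxS, zero_mul])) (isClosed_tsupport f)
  have hwdiff (x) (hx : x ∈ S) : ContDiffAt ℝ 1 w x :=
    contDiffAt_hardyWeight hR hc0 (hsupp hx).2 (by simpa using (hsupp hx).1) (-a) (1 - b)
  have hGdiff : ContDiff ℝ 1 G := contDiff_iff_contDiffAt.2 fun x => by
    by_cases hx : x ∈ S
    · exact hφ.contDiffAt.mul (hwdiff x hx)
    · exact contDiffAt_const.congr_of_eventuallyEq
        (notMem_tsupport_iff_eventuallyEq.1 fun h => hx (hGS h))
  obtain ⟨hEint, hE⟩ :=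
    integral_fderiv_self_add_mul_eq_zero hGdiff (hScomp.of_isClosed_subset (isClosed_tsupport G) hGS)
  have hpoint (x : EuclideanSpace ℝ (Fin n)) :
      K ^ p * (‖f x‖ ^ p / (‖x‖ ^ a * (1 - (‖x‖ / R) ^ c) ^ b)) +
        (n - a - (b - 1) * c) * K ^ (p - 1) *
          (‖f x‖ ^ p / (‖x‖ ^ a * (1 - (‖x‖ / R) ^ c) ^ (b - 1))) ≤
      ‖radDeriv f x‖ ^ p / (‖x‖ ^ (a - p) * (1 - (‖x‖ / R) ^ c) ^ (b - p)) +
        K ^ (p - 1) * (fderiv ℝ G x x + n * G x) := by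
    by_cases hx : x ∈ S
    swap
    · have hG0 : fderiv ℝ G x = 0 :=
        Function.notMem_support.1 fun h => hx (hGS (support_fderiv_subset ℝ h))
      simp only [hfp0 x hx, hrad0 x hx, hG0, G]
      simp
    have hx0 : x ≠ 0 := (hsupp hx).2
    have hr : 0 < ‖x‖ := norm_pos_iff.2 hx0
    have hxR : ‖x‖ < R := by simpa using (hsupp hx).1
    have hu := one_sub_norm_div_rpow_pos hR hc0 hxR
    have hnorm : DifferentiableAt ℝ (fun x : EuclideanSpace ℝ (Fin n) => ‖x‖) x :=
      (contDiffAt_norm ℝ (n := 1) hx0).differentiableAt one_ne_zero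
    have hw' := (hasDerivAt_hardyWeight (a := a) (b := b) hR hc0 hr hxR).comp_hasFDerivAt x
      hnorm.hasFDerivAt
    have hG' : fderiv ℝ G x x = ‖f x‖ ^ p * ((b - 1) * c *
          (1 / (‖x‖ ^ a * (1 - (‖x‖ / R) ^ c) ^ b)) -
        (a + (b - 1) * c) * (1 / (‖x‖ ^ a * (1 - (‖x‖ / R) ^ c) ^ (b - 1)))) +
        w x * fderiv ℝ (fun x => ‖f x‖ ^ p) x x := by
      have h := ((hφ.differentiable one_ne_zero x).hasFDerivAt.mul hw').fderiv
      change fderiv ℝ G x = _ at h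
      rw [h]
      simp only [add_apply, smul_apply, smul_eq_mul, hnorm.fderiv_norm_self, Function.comp, w]
      field_simp
    have hw_eq : w x = 1 / (‖x‖ ^ a * (1 - (‖x‖ / R) ^ c) ^ (b - 1)) := by
      simp only [w]
      rw [show 1 - b = -(b - 1) by ring, Real.rpow_neg hr.le, Real.rpow_neg hu.le]
      field_simp
    have hrad : ‖fderiv ℝ f x x‖ = ‖x‖ * ‖radDeriv f x‖ := by
      rw [radDeriv, map_smul, norm_smul, norm_inv, norm_norm, mul_inv_cancel_left₀ hr.ne']
    have hder : -(p * ‖f x‖ ^ (p - 1) * (‖x‖ * ‖radDeriv f x‖)) ≤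
        fderiv ℝ (fun x => ‖f x‖ ^ p) x x := by
      rw [← hrad]
      exact neg_le_of_abs_le (abs_fderiv_norm_rpow_apply_le (hf.differentiable one_ne_zero x) hp x)
    have hwpos : 0 < w x := by simp only [w]; positivity
    have hyoung := weighted_young_inequality (a := a) (b := b) hp hKpos.le (norm_nonneg (f x))
      (norm_nonneg (radDeriv f x)) hr hu
    have hmul := mul_le_mul_of_nonneg_left hder (by positivity : 0 ≤ K ^ (p - 1) * w x)
    have hKp : K ^ (p - 1) * ((b - 1) * c) = p * K ^ p := by
      rw [show (b - 1) * c = p * K by rw [hK]; field_simp, Real.rpow_sub hKpos, Real.rpow_one]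
      field_simp
    rw [hG']
    simp only [G]
    change K ^ (p - 1) * (w x * _) ≤ _ at hyoung
    rw [hw_eq] at hyoung hmul ⊢
    rw [div_eq_mul_one_div (‖f x‖ ^ p)] at hyoung ⊢
    rw [div_eq_mul_one_div (‖f x‖ ^ p) (‖x‖ ^ a * (1 - (‖x‖ / R) ^ c) ^ (b - 1))]
    linear_combination hyoung + hmul -
      ‖f x‖ ^ p * (1 / (‖x‖ ^ a * (1 - (‖x‖ / R) ^ c) ^ b)) * hKp
  have hmono := integral_mono (((hint a b).const_mul _).add ((hint a (b - 1)).const_mul _))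
    (hintrad.add (hEint.const_mul _)) hpoint
  simp only [Pi.add_apply] at hmono
  rwa [integral_add ((hint a b).const_mul _) ((hint a (b - 1)).const_mul _),
    integral_add hintrad (hEint.const_mul _), integral_const_mul, integral_const_mul,
    integral_const_mul, hE, mul_zero, add_zero] at hmono
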